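/- arXiv:2205.11508 — 2 statements merged into one kernel-verified Lean document; each statement's English description precedes it below -/
import Mathlib

section
/- (Closed-form optimal VICReg representation.) Let N ≥ K ≥ 1, α > 0, γ ≥ 0, and let G ∈ ℝ^{N×N} be symmetric with nonnegative entries and graph Laplacian L = D − G. Let A = I_N − (1/N)𝟙𝟙ᵀ − (γ/α) L have spectral decomposition A = P diag(λ₁,…,λ_N) Pᵀ with P orthogonal and λ₁ ≥ … ≥ λ_N, and assume λ_K ≥ 0. Define the (squared-variance) VICReg loss L_vic(Z) = α‖Cov(Z) − I_K‖_F² + (γ/N) ∑_{i,j} G_{ij} ‖Z_{i,·} − Z_{j,·}‖₂². Then the matrix Z* ∈ ℝ^{N×K} whose k-th column is √(N λ_k) · P_{·,k} (k = 1,…,K) satisfies L_vic(Z*) = α(K − ∑_{k=1}^K λ_k²), and L_vic(Z) ≥ α(K − ∑_{k=1}^K λ_k²) for every Z ∈ ℝ^{N×K}. -/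
open Matrix

/-- The graph Laplacian `L = D - G` of a symmetric matrix `G`. -/
noncomputable def graphLaplacian {N : ℕ} (G : Matrix (Fin N) (Fin N) ℝ) :
    Matrix (Fin N) (Fin N) ℝ :=
  Matrix.diagonal (fun i => ∑ j, G i j) - G

/-- The centering matrix `H = I - (1/N) 𝟙𝟙ᵀ`. -/
noncomputable def centering (N : ℕ) : Matrix (Fin N) (Fin N) ℝ :=
  1 - (N : ℝ)⁻¹ • Matrix.of (fun _ _ => (1 : ℝ))

/-- The covariance `Cov(Z) = (1/N) Zᵀ H Z`. -/
noncomputable def covM {N K : ℕ} (Z : Matrix (Fin N) (Fin K) ℝ) :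
    Matrix (Fin K) (Fin K) ℝ :=
  (N : ℝ)⁻¹ • (Zᵀ * centering N * Z)

/-- Squared Frobenius norm. -/
def frobSq {m n : Type*} [Fintype m] [Fintype n] (A : Matrix m n ℝ) : ℝ :=
  ∑ i, ∑ j, (A i j) ^ 2

/-- The (squared-variance) VICReg loss
`L_vic(Z) = α ‖Cov(Z) - I‖_F² + (γ/N) ∑_{i,j} G i j ‖Z_{i,·} - Z_{j,·}‖₂²`. -/
noncomputable def vicregLoss {N K : ℕ} (α γ : ℝ) (G : Matrix (Fin N) (Fin N) ℝ)
    (Z : Matrix (Fin N) (Fin K) ℝ) : ℝ :=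
  α * frobSq (covM Z - 1) +
    (γ / N) * ∑ i, ∑ j, G i j * (∑ k, (Z i k - Z j k) ^ 2)

theorem frobSq_eq_trace {m n : Type*} [Fintype m] [Fintype n] (A : Matrix m n ℝ) :
    frobSq A = (Aᵀ * A).trace := by
  simp only [frobSq, trace, diag_apply, mul_apply, transpose_apply]
  rw [Finset.sum_comm]
  simp only [sq]

theorem frobSq_diagonal {n : Type*} [Fintype n] [DecidableEq n] (d : n → ℝ) :
    frobSq (diagonal d) = ∑ i, d i ^ 2 := by
  rw [frobSq_eq_trace]
  simp [diagonal_transpose, diagonal_mul_diagonal, trace_diagonal, sq]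

/-- A weighted sum with weights in `[0, 1]` of total mass at most `K` is at most the sum of the
`K` largest values. -/
theorem sum_mul_le_sum_castLE {N K : ℕ} (hK1 : 1 ≤ K) (hKN : K ≤ N)
    (c w : Fin N → ℝ) (hc : Antitone c) (hc0 : ∀ i, 0 ≤ c i)
    (hw0 : ∀ i, 0 ≤ w i) (hw1 : ∀ i, w i ≤ 1) (hwK : ∑ i, w i ≤ K) :
    ∑ i, c i * w i ≤ ∑ k : Fin K, c (Fin.castLE hKN k) := by
  set t := c (Fin.castLE hKN ⟨K - 1, by omega⟩)
  have hmain : ∑ i, (c i - t) * w i ≤ ∑ k : Fin K, (c (Fin.castLE hKN k) - t) := by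
    have hmap : ∑ k : Fin K, (c (Fin.castLE hKN k) - t)
        = ∑ i ∈ Finset.univ.map (Fin.castLEEmb hKN), (c i - t) := by
      simp
    have hite : ∑ i ∈ Finset.univ.map (Fin.castLEEmb hKN), (c i - t)
        = ∑ i, if i ∈ Finset.univ.map (Fin.castLEEmb hKN) then c i - t else 0 := by
      rw [Finset.sum_ite_mem, Finset.univ_inter]
    rw [hmap, hite]
    refine Finset.sum_le_sum fun i _ => ?_
    split_ifs with hi
    · obtain ⟨k, -, rfl⟩ := Finset.mem_map.1 hi
      have hle : t ≤ c (Fin.castLEEmb hKN k) := hc (by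
        rw [Fin.le_def]
        have := k.2
        simp only [Fin.castLEEmb_apply, Fin.val_castLE]
        omega)
      nlinarith [hw1 (Fin.castLEEmb hKN k)]
    · have hiK : K ≤ (i : ℕ) := by
        by_contra hlt
        exact hi (Finset.mem_map.2 ⟨⟨i, by omega⟩, Finset.mem_univ _, rfl⟩)
      have hle : c i ≤ t := hc (by rw [Fin.le_def, Fin.val_castLE]; simp only; omega)
      nlinarith [hw0 i]
  simp only [sub_mul, Finset.sum_sub_distrib, ← Finset.mul_sum, Finset.sum_const,
    Finset.card_univ, Fintype.card_fin, nsmul_eq_mul] at hmain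
  have ht0 : 0 ≤ t := hc0 _
  nlinarith

/-- Bessel's inequality for rows: if the columns of `U` are orthogonal and each is either a unit
vector or zero, then every row of `U` has norm at most one. -/
theorem sum_row_sq_le_one {m n : Type*} [Fintype m] [Fintype n] [DecidableEq n]
    (U : Matrix m n ℝ) (e : n → ℝ) (hU : Uᵀ * U = diagonal e)
    (he : ∀ i k, U i k * e k = U i k) (i : m) : ∑ k, U i k ^ 2 ≤ 1 := by
  have hUe : U * diagonal e = U := by
    ext i k
    simp [mul_diagonal, he]
  have hidem : (U * Uᵀ) * (U * Uᵀ) = U * Uᵀ := by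
    rw [Matrix.mul_assoc, ← Matrix.mul_assoc Uᵀ U, hU, ← Matrix.mul_assoc, hUe]
  have hsymm : ∀ a b, (U * Uᵀ) a b = (U * Uᵀ) b a := fun a b => by
    simp [mul_apply, mul_comm]
  have hrow : ∑ k, U i k ^ 2 = (U * Uᵀ) i i := by simp [mul_apply, sq]
  have hdiag : (U * Uᵀ) i i = ∑ j, (U * Uᵀ) i j ^ 2 := by
    conv_lhs => rw [← hidem, mul_apply]
    exact Finset.sum_congr rfl fun j _ => by rw [hsymm j i, sq]
  have hle : (U * Uᵀ) i i ^ 2 ≤ ∑ j, (U * Uᵀ) i j ^ 2 :=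
    Finset.single_le_sum (f := fun j => (U * Uᵀ) i j ^ 2) (fun j _ => sq_nonneg _)
      (Finset.mem_univ i)
  rw [hrow]
  nlinarith

theorem trace_transpose_mul_diagonal_mul {m n : Type*} [Fintype m] [Fintype n] [DecidableEq m]
    (B : Matrix m n ℝ) (d : m → ℝ) :
    (Bᵀ * diagonal d * B).trace = ∑ k, ∑ i, d i * B i k ^ 2 := by
  simp only [trace, diag_apply]
  refine Finset.sum_congr rfl fun k _ => ?_
  rw [mul_apply]
  refine Finset.sum_congr rfl fun i _ => ?_
  rw [mul_diagonal, transpose_apply]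
  ring

theorem two_mul_trace_le_of_orthogonal_columns {N K : ℕ} (hK1 : 1 ≤ K) (hKN : K ≤ N)
    (lam : Fin N → ℝ) (hdec : Antitone lam)
    (hlam0 : ∀ k : Fin K, 0 ≤ lam (Fin.castLE hKN k)) (B : Matrix (Fin N) (Fin K) ℝ) (s : Fin K → ℝ) (hB : Bᵀ * B = diagonal s) :
    2 * (Bᵀ * diagonal lam * B).trace
      ≤ ∑ k, s k ^ 2 + ∑ k : Fin K, lam (Fin.castLE hKN k) ^ 2 := by
  have hinner : ∀ k l, ∑ i, B i k * B i l = diagonal s k l := fun k l => by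
    rw [← hB]; simp [mul_apply]
  have hs : ∀ k, ∑ i, B i k ^ 2 = s k := fun k => by
    simpa [sq] using hinner k k
  have hs0 : ∀ k, 0 ≤ s k := fun k => hs k ▸ Finset.sum_nonneg fun i _ => sq_nonneg _
  have hzero : ∀ i k, s k = 0 → B i k = 0 := fun i k hk => by
    have h := (Finset.sum_eq_zero_iff_of_nonneg fun i _ => sq_nonneg (B i k)).1
      ((hs k).trans hk) i (Finset.mem_univ i)
    exact pow_eq_zero_iff two_ne_zero |>.1 h
  set U : Matrix (Fin N) (Fin K) ℝ := of fun i k => B i k / √(s k) with hUdef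
  set e : Fin K → ℝ := fun k => if s k = 0 then 0 else 1 with hedef
  have hU : Uᵀ * U = diagonal e := by
    ext k l
    have hkl : (Uᵀ * U) k l = (∑ i, B i k * B i l) / (√(s k) * √(s l)) := by
      simp only [hUdef, mul_apply, transpose_apply, of_apply, Finset.sum_div]
      exact Finset.sum_congr rfl fun i _ => by rw [div_mul_div_comm]
    rw [hkl, hinner]
    by_cases h : k = l
    · subst h
      by_cases hk : s k = 0
      · simp [hedef, hk]
      · simp [hedef, hk, Real.mul_self_sqrt (hs0 k)]
    · simp [h]
  have he : ∀ i k, U i k * e k = U i k := fun i k => by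
    by_cases hk : s k = 0 <;> simp [hUdef, hedef, hk]
  have hBU : ∀ i k, B i k ^ 2 = s k * U i k ^ 2 := fun i k => by
    by_cases hk : s k = 0
    · simp [hk, hzero i k hk]
    · simp only [hUdef, of_apply, div_pow, Real.sq_sqrt (hs0 k)]
      field_simp
  have hcol : ∀ k, ∑ i, U i k ^ 2 = e k := fun k => by
    have h := congrFun (congrFun hU k) k
    simpa [mul_apply, sq] using h
  have he1 : ∀ k, e k ≤ 1 := fun k => by
    simp only [hedef]; split_ifs <;> norm_num
  set c : Fin N → ℝ := fun i => max (lam i) 0 ^ 2 with hcdef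
  have hterm : 2 * (Bᵀ * diagonal lam * B).trace
      ≤ ∑ k, ∑ i, (s k ^ 2 * U i k ^ 2 + c i * U i k ^ 2) := by
    rw [trace_transpose_mul_diagonal_mul, Finset.mul_sum]
    refine Finset.sum_le_sum fun k _ => ?_
    rw [Finset.mul_sum]
    refine Finset.sum_le_sum fun i _ => ?_
    rw [hBU]
    have h1 : 2 * (lam i * s k) ≤ s k ^ 2 + c i := by
      have h2 : lam i * s k ≤ max (lam i) 0 * s k :=
        mul_le_mul_of_nonneg_right (le_max_left _ _) (hs0 k)
      simp only [hcdef]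
      nlinarith [sq_nonneg (s k - max (lam i) 0)]
    nlinarith [mul_le_mul_of_nonneg_right h1 (sq_nonneg (U i k))]
  have hsq : ∑ k, ∑ i, s k ^ 2 * U i k ^ 2 ≤ ∑ k, s k ^ 2 := by
    refine Finset.sum_le_sum fun k _ => ?_
    rw [← Finset.mul_sum, hcol]
    exact mul_le_of_le_one_right (sq_nonneg _) (he1 k)
  have hweights : ∑ k, ∑ i, c i * U i k ^ 2 ≤ ∑ k : Fin K, c (Fin.castLE hKN k) := by
    rw [Finset.sum_comm]
    simp only [← Finset.mul_sum]
    refine sum_mul_le_sum_castLE hK1 hKN c _ ?_ (fun i => sq_nonneg _)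
      (fun i => Finset.sum_nonneg fun k _ => sq_nonneg _) (sum_row_sq_le_one U e hU he) ?_
    · intro i j hij
      exact pow_le_pow_left₀ (le_max_right _ _) (max_le_max_right 0 (hdec hij)) 2
    · rw [Finset.sum_comm]
      simp only [hcol]
      calc ∑ k, e k ≤ ∑ _k : Fin K, (1 : ℝ) := Finset.sum_le_sum fun k _ => he1 k
        _ = K := by simp
  have hpos : ∑ k : Fin K, c (Fin.castLE hKN k) = ∑ k : Fin K, lam (Fin.castLE hKN k) ^ 2 := by
    refine Finset.sum_congr rfl fun k _ => ?_
    simp only [hcdef, max_eq_left (hlam0 k)]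
  simp only [Finset.sum_add_distrib] at hterm
  linarith

theorem two_mul_trace_le_frobSq_add {N K : ℕ} (hK1 : 1 ≤ K) (hKN : K ≤ N)
    (lam : Fin N → ℝ) (hdec : Antitone lam)
    (hlam0 : ∀ k : Fin K, 0 ≤ lam (Fin.castLE hKN k)) (Y : Matrix (Fin N) (Fin K) ℝ) :
    2 * (Yᵀ * diagonal lam * Y).trace
      ≤ frobSq (Yᵀ * Y) + ∑ k : Fin K, lam (Fin.castLE hKN k) ^ 2 := by
  have hY : (Yᵀ * Y).IsHermitian := by
    simpa [conjTranspose_eq_transpose_of_trivial] using isHermitian_conjTranspose_mul_self Y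
  set Q : Matrix (Fin K) (Fin K) ℝ := ↑hY.eigenvectorUnitary
  have hQ1 : Qᵀ * Q = 1 := by
    simpa [star_eq_conjTranspose, conjTranspose_eq_transpose_of_trivial] using
      Unitary.coe_star_mul_self hY.eigenvectorUnitary
  have hQ2 : Q * Qᵀ = 1 := mul_eq_one_comm.1 hQ1
  have hspec : Yᵀ * Y = Q * diagonal hY.eigenvalues * Qᵀ := by
    have h := hY.spectral_theorem
    simpa [Unitary.conjStarAlgAut_apply, star_eq_conjTranspose,
      conjTranspose_eq_transpose_of_trivial, Function.comp_def] using h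
  have hB : (Y * Q)ᵀ * (Y * Q) = diagonal hY.eigenvalues := by
    calc (Y * Q)ᵀ * (Y * Q) = Qᵀ * (Yᵀ * Y) * Q := by
          simp only [transpose_mul, Matrix.mul_assoc]
      _ = Qᵀ * (Q * diagonal hY.eigenvalues * Qᵀ) * Q := congrArg (Qᵀ * · * Q) hspec
      _ = (Qᵀ * Q) * diagonal hY.eigenvalues * (Qᵀ * Q) := by
          simp only [Matrix.mul_assoc]
      _ = _ := by simp [hQ1]
  have hfrob : frobSq (Yᵀ * Y) = ∑ k, hY.eigenvalues k ^ 2 := by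
    rw [← frobSq_diagonal, ← hB, frobSq_eq_trace, frobSq_eq_trace]
    calc ((Yᵀ * Y)ᵀ * (Yᵀ * Y)).trace
        = ((Yᵀ * Y)ᵀ * (Yᵀ * Y) * (Q * Qᵀ)).trace := by rw [hQ2, Matrix.mul_one]
      _ = (Qᵀ * ((Yᵀ * Y)ᵀ * (Yᵀ * Y) * Q)).trace := by
          rw [← Matrix.mul_assoc, trace_mul_comm]
      _ = (Qᵀ * ((Yᵀ * Y)ᵀ * (Q * Qᵀ) * (Yᵀ * Y) * Q)).trace := by rw [hQ2, Matrix.mul_one]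
      _ = _ := by
          simp only [transpose_mul, transpose_transpose, Matrix.mul_assoc]
  have htrace : ((Y * Q)ᵀ * diagonal lam * (Y * Q)).trace = (Yᵀ * diagonal lam * Y).trace := by
    calc ((Y * Q)ᵀ * diagonal lam * (Y * Q)).trace
        = (Qᵀ * (Yᵀ * diagonal lam * Y * Q)).trace := by
          simp only [transpose_mul, Matrix.mul_assoc]
      _ = (Yᵀ * diagonal lam * Y * (Q * Qᵀ)).trace := by
          rw [trace_mul_comm, Matrix.mul_assoc]
      _ = _ := by rw [hQ2, Matrix.mul_one]
  rw [← htrace, hfrob]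
  exact two_mul_trace_le_of_orthogonal_columns hK1 hKN lam hdec hlam0 _ _ hB

theorem graphLaplacian_mul_ones {N : ℕ} (G : Matrix (Fin N) (Fin N) ℝ) :
    graphLaplacian G * of (fun _ _ : Fin N => (1 : ℝ)) = 0 := by
  ext i j
  simp [graphLaplacian, mul_apply, diagonal_apply]

theorem transpose_graphLaplacian {N : ℕ} {G : Matrix (Fin N) (Fin N) ℝ} (hG : G.IsSymm) :
    (graphLaplacian G)ᵀ = graphLaplacian G := by
  simp [graphLaplacian, hG.eq]

theorem transpose_centering (N : ℕ) : (centering N)ᵀ = centering N := by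
  ext i j
  simp [centering, one_apply, eq_comm]

theorem ones_mul_ones (N : ℕ) :
    (of fun _ _ : Fin N => (1 : ℝ)) * of (fun _ _ => (1 : ℝ))
      = (N : ℝ) • of fun _ _ : Fin N => (1 : ℝ) := by
  ext i j
  simp [mul_apply]

theorem centering_mul_ones {N : ℕ} (hN : N ≠ 0) :
    centering N * of (fun _ _ : Fin N => (1 : ℝ)) = 0 := by
  have hN' : (N : ℝ) ≠ 0 := Nat.cast_ne_zero.2 hN
  rw [centering, Matrix.sub_mul, Matrix.one_mul, Matrix.smul_mul, ones_mul_ones, smul_smul,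
    inv_mul_cancel₀ hN', one_smul, sub_self]

theorem mul_centering_of_mul_ones {N : ℕ} {M : Matrix (Fin N) (Fin N) ℝ}
    (hM : M * of (fun _ _ : Fin N => (1 : ℝ)) = 0) : M * centering N = M := by
  rw [centering, Matrix.mul_sub, Matrix.mul_smul, hM, Matrix.mul_one, smul_zero, sub_zero]

/-- Dirichlet energy of a symmetric weighted graph as a Laplacian quadratic form. -/
theorem sum_mul_sum_sub_sq {N K : ℕ} {G : Matrix (Fin N) (Fin N) ℝ} (hG : G.IsSymm)
    (Z : Matrix (Fin N) (Fin K) ℝ) :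
    ∑ i, ∑ j, G i j * (∑ k, (Z i k - Z j k) ^ 2)
      = 2 * (Zᵀ * graphLaplacian G * Z).trace := by
  have hD : (Zᵀ * diagonal (fun i => ∑ j, G i j) * Z).trace
      = ∑ i, ∑ j, ∑ k, G i j * Z i k ^ 2 := by
    rw [trace_transpose_mul_diagonal_mul, Finset.sum_comm]
    refine Finset.sum_congr rfl fun i _ => ?_
    rw [Finset.sum_comm]
    exact Finset.sum_congr rfl fun k _ => by rw [Finset.sum_mul]
  have hD' : ∑ i, ∑ j, ∑ k, G i j * Z j k ^ 2 = ∑ i, ∑ j, ∑ k, G i j * Z i k ^ 2 := by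
    rw [Finset.sum_comm]
    simp only [hG.apply]
  have hC : (Zᵀ * G * Z).trace = ∑ i, ∑ j, ∑ k, G i j * (Z i k * Z j k) := by
    rw [Matrix.mul_assoc, trace_mul_comm]
    simp only [trace, diag_apply, mul_apply, transpose_apply, Finset.sum_mul]
    refine Finset.sum_congr rfl fun i _ => ?_
    rw [Finset.sum_comm]
    exact Finset.sum_congr rfl fun j _ => Finset.sum_congr rfl fun k _ => by ring
  rw [graphLaplacian, Matrix.mul_sub, Matrix.sub_mul, trace_sub, hD, hC, mul_sub, two_mul]
  nth_rewrite 2 [← hD']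
  rw [Finset.mul_sum]
  simp only [Finset.mul_sum, ← Finset.sum_add_distrib, ← Finset.sum_sub_distrib]
  refine Finset.sum_congr rfl fun i _ => Finset.sum_congr rfl fun j _ =>
    Finset.sum_congr rfl fun k _ => by ring

theorem frobSq_sub_one {K : ℕ} (C : Matrix (Fin K) (Fin K) ℝ) :
    frobSq (C - 1) = frobSq C - 2 * C.trace + K := by
  simp only [frobSq_eq_trace, transpose_sub, transpose_one, Matrix.sub_mul, Matrix.mul_sub,
    Matrix.one_mul, Matrix.mul_one, trace_sub, trace_transpose, trace_one, Fintype.card_fin]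
  ring

theorem vicregLoss_eq {N K : ℕ} {α γ : ℝ} (hα : α ≠ 0) {G : Matrix (Fin N) (Fin N) ℝ}
    (hG : G.IsSymm) (Z : Matrix (Fin N) (Fin K) ℝ) :
    vicregLoss α γ G Z = α * (K + frobSq (covM Z)
      - 2 * ((N : ℝ)⁻¹ * (Zᵀ * (centering N - (γ / α) • graphLaplacian G) * Z).trace)) := by
  rw [vicregLoss, sum_mul_sum_sub_sq hG, frobSq_sub_one]
  simp only [covM, Matrix.mul_sub, Matrix.sub_mul, trace_sub, Matrix.mul_smul, Matrix.smul_mul,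
    trace_smul, smul_eq_mul]
  field_simp
  ring

/-- Closed-form optimal VICReg representation: with
`A = I - (1/N)𝟙𝟙ᵀ - (γ/α) L = P diag(λ) Pᵀ`, `P` orthogonal, `λ` descending with
`λ_K ≥ 0`, the matrix `Z*` with `k`-th column `√(N λ_k) P_{·,k}` achieves the loss
`α (K - ∑_{k=1}^K λ_k²)`, which lower-bounds the VICReg loss over all `Z ∈ ℝ^{N×K}`. -/
theorem vicreg_closed_form_optimum {N K : ℕ} (hK1 : 1 ≤ K) (hKN : K ≤ N)
    (α γ : ℝ) (hα : 0 < α) (hγ : 0 ≤ γ)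
    (G : Matrix (Fin N) (Fin N) ℝ) (hGsym : G.IsSymm) (hGnn : ∀ i j, 0 ≤ G i j)
    (P : Matrix (Fin N) (Fin N) ℝ) (hP : P ∈ Matrix.orthogonalGroup (Fin N) ℝ)
    (lam : Fin N → ℝ) (hdec : Antitone lam)
    (hA : (1 : Matrix (Fin N) (Fin N) ℝ)
            - (N : ℝ)⁻¹ • Matrix.of (fun _ _ => (1 : ℝ))
            - (γ / α) • graphLaplacian G
          = P * Matrix.diagonal lam * Pᵀ)
    (hlamK : 0 ≤ lam ⟨K - 1, by omega⟩) :
    vicregLoss α γ G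
        (Matrix.of fun i (k : Fin K) =>
          Real.sqrt ((N : ℝ) * lam (Fin.castLE hKN k)) * P i (Fin.castLE hKN k))
      = α * ((K : ℝ) - ∑ k : Fin K, (lam (Fin.castLE hKN k)) ^ 2)
    ∧ ∀ Z : Matrix (Fin N) (Fin K) ℝ,
        α * ((K : ℝ) - ∑ k : Fin K, (lam (Fin.castLE hKN k)) ^ 2)
          ≤ vicregLoss α γ G Z := by
  have hN : N ≠ 0 := by omega
  have hN0 : (0 : ℝ) < N := Nat.cast_pos.2 (Nat.pos_of_ne_zero hN)
  have hPP : Pᵀ * P = 1 := by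
    simpa [star_eq_conjTranspose, conjTranspose_eq_transpose_of_trivial] using
      (mem_orthogonalGroup_iff' (Fin N) ℝ).1 hP
  have hPP' : P * Pᵀ = 1 := mul_eq_one_comm.1 hPP
  set A := centering N - (γ / α) • graphLaplacian G with hAdef
  have hAP : A = P * diagonal lam * Pᵀ := hA
  have hA1 : A * of (fun _ _ : Fin N => (1 : ℝ)) = 0 := by
    rw [hAdef, Matrix.sub_mul, Matrix.smul_mul, graphLaplacian_mul_ones, centering_mul_ones hN,
      smul_zero, sub_zero]
  have hAT : Aᵀ = A := by
    rw [hAdef, transpose_sub, transpose_smul, transpose_centering, transpose_graphLaplacian hGsym]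
  have hAH : A * centering N = A := mul_centering_of_mul_ones hA1
  have hHA : centering N * A = A := by
    simpa [transpose_mul, hAT, transpose_centering] using congrArg transpose hAH
  have hHH : centering N * centering N = centering N :=
    mul_centering_of_mul_ones (centering_mul_ones hN)
  have hroot : (√(N : ℝ))⁻¹ * (√(N : ℝ))⁻¹ = (N : ℝ)⁻¹ := by
    rw [← mul_inv, Real.mul_self_sqrt hN0.le]
  have hlam0 : ∀ k : Fin K, 0 ≤ lam (Fin.castLE hKN k) := fun k => hlamK.trans (hdec (by
    rw [Fin.le_def]
    have := k.2
    simp only [Fin.val_castLE]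
    omega))
  refine ⟨?_, fun Z => ?_⟩
  · set Z : Matrix (Fin N) (Fin K) ℝ := Matrix.of fun i (k : Fin K) =>
      √((N : ℝ) * lam (Fin.castLE hKN k)) * P i (Fin.castLE hKN k) with hZdef
    have horth : ∀ k l, ∑ i, P i k * P i l = (1 : Matrix (Fin N) (Fin N) ℝ) k l := fun k l => by
      rw [← hPP]; simp [mul_apply]
    have hZZ : Zᵀ * Z = (N : ℝ) • diagonal fun k => lam (Fin.castLE hKN k) := by
      ext k l
      have hkl : (Zᵀ * Z) k l = √((N : ℝ) * lam (Fin.castLE hKN k)) *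
          √((N : ℝ) * lam (Fin.castLE hKN l)) *
            ∑ i, P i (Fin.castLE hKN k) * P i (Fin.castLE hKN l) := by
        simp only [hZdef, mul_apply, transpose_apply, of_apply, Finset.mul_sum]
        exact Finset.sum_congr rfl fun i _ => by ring
      rw [hkl, horth]
      by_cases h : k = l
      · subst h
        rw [Real.mul_self_sqrt (mul_nonneg hN0.le (hlam0 k))]
        simp
      · simp [h]
    have hAZ : A * Z = Z * diagonal fun k => lam (Fin.castLE hKN k) := by
      have hAP2 : A * P = P * diagonal lam := by
        rw [hAP, Matrix.mul_assoc, hPP, Matrix.mul_one]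
      ext i k
      have h := congrFun (congrFun hAP2 i) (Fin.castLE hKN k)
      rw [mul_apply, mul_diagonal] at h
      rw [mul_apply, mul_diagonal]
      simp only [hZdef, of_apply]
      rw [mul_assoc, ← h, Finset.mul_sum]
      exact Finset.sum_congr rfl fun j _ => by ring
    have hHZ : centering N * Z = Z := by
      have hHAZ : centering N * Z * diagonal (fun k => lam (Fin.castLE hKN k))
          = Z * diagonal fun k => lam (Fin.castLE hKN k) := by
        rw [Matrix.mul_assoc, ← hAZ, ← Matrix.mul_assoc, hHA]
      ext i k
      by_cases hk : lam (Fin.castLE hKN k) = 0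
      · simp [hZdef, mul_apply, hk]
      · have h := congrFun (congrFun hHAZ i) k
        rw [mul_diagonal, mul_diagonal] at h
        exact mul_right_cancel₀ hk h
    have hcov : covM Z = diagonal fun k => lam (Fin.castLE hKN k) := by
      rw [covM, Matrix.mul_assoc, hHZ, hZZ, smul_smul, inv_mul_cancel₀ hN0.ne', one_smul]
    rw [vicregLoss_eq hα.ne' hGsym, hcov, frobSq_diagonal, ← hAdef, Matrix.mul_assoc, hAZ,
      ← Matrix.mul_assoc, hZZ, Matrix.smul_mul, trace_smul, diagonal_mul_diagonal,
      trace_diagonal, smul_eq_mul, inv_mul_cancel_left₀ hN0.ne']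
    simp only [← sq]
    ring
  · set Y := (√(N : ℝ))⁻¹ • (Pᵀ * (centering N * Z)) with hYdef
    have hYT : Yᵀ = (√(N : ℝ))⁻¹ • (Zᵀ * centering N * P) := by
      simp [hYdef, transpose_mul, transpose_centering]
    have hYY : Yᵀ * Y = covM Z := by
      rw [hYT, hYdef, Matrix.smul_mul, Matrix.mul_smul, smul_smul, hroot, covM]
      congr 1
      calc Zᵀ * centering N * P * (Pᵀ * (centering N * Z))
          = Zᵀ * (centering N * (P * Pᵀ) * centering N) * Z := by
            simp only [Matrix.mul_assoc]
        _ = _ := by rw [hPP', Matrix.mul_one, hHH]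
    have hYA : (Yᵀ * diagonal lam * Y).trace = (N : ℝ)⁻¹ * (Zᵀ * A * Z).trace := by
      rw [hYT, hYdef, Matrix.smul_mul, Matrix.smul_mul, Matrix.mul_smul, smul_smul, hroot,
        trace_smul, smul_eq_mul]
      congr 2
      calc Zᵀ * centering N * P * diagonal lam * (Pᵀ * (centering N * Z))
          = Zᵀ * (centering N * (P * diagonal lam * Pᵀ) * centering N) * Z := by
            simp only [Matrix.mul_assoc]
        _ = _ := by rw [← hAP, hHA, hAH]
    have hbound := two_mul_trace_le_frobSq_add hK1 hKN lam hdec hlam0 Y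
    rw [hYY, hYA] at hbound
    rw [vicregLoss_eq hα.ne' hGsym]
    exact mul_le_mul_of_nonneg_left (by linarith) hα.le
end

section
/- (Constrained VICReg recovers Laplacian Eigenmaps.) Let L ∈ ℝ^{N×N} be symmetric positive semidefinite with L·𝟙 = 0, with eigenvalues 0 = μ₁ ≤ μ₂ ≤ … ≤ μ_N and a corresponding orthonormal basis of eigenvectors v₁ = 𝟙/√N, v₂, …, v_N. Then for every 1 ≤ K ≤ N−1, the minimum of Tr(Zᵀ L Z) over all Z ∈ ℝ^{N×K} satisfying Zᵀ Z = N·I_K and 𝟙ᵀ Z = 0 equals N·∑_{k=2}^{K+1} μ_k, and it is attained at Z = √N · [v₂, …, v_{K+1}]. -/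
open Matrix

/-- If the weights `c` are at most `a` on `s`, have total mass `a * #s`, and the values `μ` are
at most `t` on `s` and at least `t` at the points outside `s` carrying mass, then the weighted sum
of `μ` is at least `a` times the sum of `μ` over `s`. -/
theorem mul_sum_le_sum_mul_of_threshold {ι : Type*} [Fintype ι] [DecidableEq ι] (s : Finset ι)
    (μ c : ι → ℝ) (a t : ℝ) (hs : ∀ i ∈ s, μ i ≤ t ∧ c i ≤ a)
    (hsc : ∀ i ∉ s, 0 ≤ (μ i - t) * c i) (hc : ∑ i, c i = a * s.card) :
    a * ∑ i ∈ s, μ i ≤ ∑ i, μ i * c i := by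
  have key : 0 ≤ ∑ i, (μ i - t) * (c i - if i ∈ s then a else 0) := by
    refine Finset.sum_nonneg fun i _ => ?_
    split_ifs with h
    · exact mul_nonneg_of_nonpos_of_nonpos (by linarith [(hs i h).1]) (by linarith [(hs i h).2])
    · simpa using hsc i h
  have expand : ∑ i, (μ i - t) * (c i - if i ∈ s then a else 0)
      = ∑ i, μ i * c i - a * ∑ i ∈ s, μ i - t * (∑ i, c i - a * s.card) := by
    simp only [mul_sub, sub_mul, Finset.sum_sub_distrib, mul_ite, mul_zero, Finset.sum_ite_mem,
      Finset.univ_inter, Finset.mul_sum, Finset.sum_const, nsmul_eq_mul]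
    simp only [mul_comm a]
    ring
  rw [expand, hc] at key
  linarith

/-- The squared norm of a row of a matrix with orthogonal columns of squared norm `a` is at most
`a`. -/
theorem sum_sq_row_le_of_transpose_mul_self {m n : Type*} [Fintype m] [Fintype n] [DecidableEq n]
    {a : ℝ} (ha : 0 ≤ a) (W : Matrix m n ℝ) (hW : Wᵀ * W = a • 1) (i : m) :
    ∑ k, W i k ^ 2 ≤ a := by
  have hP : (W * Wᵀ) * (W * Wᵀ) = a • (W * Wᵀ) := by
    rw [Matrix.mul_assoc, ← Matrix.mul_assoc Wᵀ, hW]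
    simp
  have hdiag : (W * Wᵀ) i i = ∑ k, W i k ^ 2 := by
    simp [Matrix.mul_apply, sq]
  have hsymm : ∀ j, (W * Wᵀ) j i = (W * Wᵀ) i j := fun j => by
    simp [Matrix.mul_apply, mul_comm]
  have hii : ∑ j, (W * Wᵀ) i j ^ 2 = a * (W * Wᵀ) i i := by
    have h := congrFun (congrFun hP i) i
    rw [Matrix.mul_apply] at h
    simpa [hsymm, ← sq] using h
  have hle : (W * Wᵀ) i i ^ 2 ≤ a * (W * Wᵀ) i i :=
    hii ▸ Finset.single_le_sum (f := fun j => (W * Wᵀ) i j ^ 2)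
      (fun j _ => sq_nonneg _) (Finset.mem_univ i)
  rw [← hdiag]
  by_contra! h
  nlinarith

/-- The trace form of a matrix in the coordinates of an orthonormal eigenbasis, given by the rows
of `V`. -/
theorem trace_transpose_mul_mul_eq_sum_eigenvalues {m n : Type*} [Fintype m] [DecidableEq m]
    [Fintype n] (L V : Matrix m m ℝ) (μ : m → ℝ) (hV : Vᵀ * V = 1)
    (heig : ∀ i, L *ᵥ V i = μ i • V i) (Z : Matrix m n ℝ) :
    (Zᵀ * L * Z).trace = ∑ i, μ i * ∑ k, (V * Z) i k ^ 2 := by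
  have hLV : L * Vᵀ = Vᵀ * diagonal μ := by
    ext i j
    rw [Matrix.mul_diagonal]
    exact (congrFun (heig j) i).trans (mul_comm _ _)
  have hL : L = Vᵀ * diagonal μ * V := by
    rw [← hLV, Matrix.mul_assoc, hV, Matrix.mul_one]
  have hZ : Zᵀ * L * Z = (V * Z)ᵀ * (diagonal μ * (V * Z)) := by
    rw [hL, transpose_mul]
    simp only [Matrix.mul_assoc]
  rw [hZ, Matrix.trace_mul_comm, Matrix.trace]
  refine Finset.sum_congr rfl fun i _ => ?_
  rw [diag_apply, Matrix.mul_apply, Finset.mul_sum]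
  refine Finset.sum_congr rfl fun k _ => ?_
  rw [diagonal_mul, transpose_apply]
  ring

/-- Constrained VICReg recovers Laplacian Eigenmaps: for a PSD Laplacian `L` with
`L 𝟙 = 0`, eigenvalues `0 = μ₁ ≤ μ₂ ≤ ... ≤ μ_N` and orthonormal eigenvectors
`v₁ = 𝟙/√N, v₂, ..., v_N`, the minimum of `Tr(Zᵀ L Z)` over all `Z ∈ ℝ^{N×K}` with
`Zᵀ Z = N·I_K` and `𝟙ᵀ Z = 0` equals `N·∑_{k=2}^{K+1} μ_k`, attained at
`Z = √N [v₂, ..., v_{K+1}]`. -/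
theorem constrained_vicreg_laplacian_eigenmaps {N K : ℕ}
    (hK1 : 1 ≤ K) (hKN : K ≤ N - 1)
    (L : Matrix (Fin N) (Fin N) ℝ) (hsym : L.IsSymm) (hpsd : L.PosSemidef)
    (hL1 : L *ᵥ (fun _ => (1 : ℝ)) = 0)
    (μ : Fin N → ℝ) (v : Fin N → Fin N → ℝ)
    (hmono : Monotone μ) (hμ0 : μ ⟨0, by omega⟩ = 0)
    (horth : ∀ i j, v i ⬝ᵥ v j = if i = j then (1 : ℝ) else 0)
    (heig : ∀ i, L *ᵥ v i = μ i • v i)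
    (hv0 : v ⟨0, by omega⟩ = fun _ => 1 / Real.sqrt N) :
    (letI Zopt : Matrix (Fin N) (Fin K) ℝ :=
        Matrix.of fun i (k : Fin K) =>
          Real.sqrt N * v ⟨k.val + 1, by have := k.isLt; omega⟩ i
     Zoptᵀ * Zopt = (N : ℝ) • 1
       ∧ (fun _ => (1 : ℝ)) ᵥ* Zopt = 0
       ∧ Matrix.trace (Zoptᵀ * L * Zopt)
          = (N : ℝ) * ∑ k : Fin K, μ ⟨k.val + 1, by have := k.isLt; omega⟩)
    ∧ ∀ Z : Matrix (Fin N) (Fin K) ℝ,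
        Zᵀ * Z = (N : ℝ) • 1 →
        (fun _ => (1 : ℝ)) ᵥ* Z = 0 →
        (N : ℝ) * ∑ k : Fin K, μ ⟨k.val + 1, by have := k.isLt; omega⟩
          ≤ Matrix.trace (Zᵀ * L * Z) := by
  have hN : 0 < N := by omega
  have hNR : (0 : ℝ) ≤ N := Nat.cast_nonneg N
  have hsqrt : Real.sqrt N ≠ 0 := (Real.sqrt_pos.mpr (Nat.cast_pos.mpr hN)).ne'
  let e : Fin K ↪ Fin N :=
    ⟨fun k => ⟨k.val + 1, by have := k.isLt; omega⟩, fun a b h => by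
      simpa [Fin.ext_iff] using h⟩
  have he : ∀ k : Fin K, e k = ⟨k.val + 1, by have := k.isLt; omega⟩ := fun _ => rfl
  have hV : (Matrix.of v)ᵀ * Matrix.of v = 1 := by
    refine mul_eq_one_comm.mp ?_
    ext i j
    simpa [Matrix.mul_apply, dotProduct, Matrix.one_apply] using horth i j
  have htrace := trace_transpose_mul_mul_eq_sum_eigenvalues (n := Fin K) L (Matrix.of v) μ hV heig
  have hone : (fun _ : Fin N => (1 : ℝ)) = Real.sqrt N • v ⟨0, hN⟩ := by
    rw [hv0]
    ext i
    simp [hsqrt]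
  refine ⟨⟨?_, ?_, ?_⟩, fun Z hZ hZ1 => ?_⟩
  · ext k l
    have h : v (e k) ⬝ᵥ v (e l) = if k = l then (1 : ℝ) else 0 := by
      simp [horth]
    calc _ = (Real.sqrt N * Real.sqrt N) * (v (e k) ⬝ᵥ v (e l)) := by
          simp only [Matrix.mul_apply, transpose_apply, of_apply, dotProduct, Finset.mul_sum]
          exact Finset.sum_congr rfl fun i _ => by
            rw [he, he]
            ring
      _ = _ := by
          rw [h, Real.mul_self_sqrt hNR]
          simp [Matrix.one_apply]
  · ext k
    have h : v ⟨0, hN⟩ ⬝ᵥ v (e k) = 0 := by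
      rw [horth, if_neg]
      simp [he]
    calc _ = (Real.sqrt N • v ⟨0, hN⟩) ⬝ᵥ (Real.sqrt N • v (e k)) := by
          rw [← hone]
          rfl
      _ = 0 := by simp [h]
  · rw [htrace]
    have hentry : ∀ i (k : Fin K), ((Matrix.of v) * (Matrix.of fun i (k : Fin K) =>
        Real.sqrt N * v ⟨k.val + 1, by have := k.isLt; omega⟩ i)) i k
        = if i = e k then Real.sqrt N else 0 := by
      intro i k
      calc _ = v i ⬝ᵥ (Real.sqrt N • v (e k)) := rfl
        _ = _ := by simp [horth]
    simp only [hentry, Finset.mul_sum]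
    rw [Finset.sum_comm]
    refine Finset.sum_congr rfl fun k _ => ?_
    simp [ite_pow, Real.sq_sqrt hNR, mul_comm, he]
  · rw [htrace]
    set W := Matrix.of v * Z with hWdef
    have hW : Wᵀ * W = (N : ℝ) • 1 := by
      rw [hWdef, transpose_mul, Matrix.mul_assoc, ← Matrix.mul_assoc _ _ Z, hV, Matrix.one_mul, hZ]
    have hW0 : ∀ k, W ⟨0, hN⟩ k = 0 := by
      intro k
      have h := congrFun hZ1 k
      rw [hone, smul_vecMul] at h
      exact (mul_eq_zero.mp h).resolve_left hsqrt
    have hsum : ∑ i, ∑ k, W i k ^ 2 = (N : ℝ) * K := by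
      have h := congrArg Matrix.trace hW
      rw [Finset.sum_comm]
      simpa [Matrix.trace, Matrix.mul_apply, ← sq, mul_comm] using h
    have hmain := mul_sum_le_sum_mul_of_threshold (Finset.univ.map e) μ (fun i => ∑ k, W i k ^ 2)
      N (μ ⟨K, by omega⟩) ?_ ?_ (by simpa using hsum)
    · simpa [Finset.sum_map, he] using hmain
    · intro i hi
      obtain ⟨k, -, rfl⟩ := Finset.mem_map.mp hi
      exact ⟨hmono (Fin.mk_le_mk.mpr k.isLt), sum_sq_row_le_of_transpose_mul_self hNR W hW _⟩
    · intro i hi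
      by_cases hi0 : i = ⟨0, hN⟩
      · simp [hi0, hW0]
      · refine mul_nonneg (sub_nonneg.mpr (hmono ?_)) (Finset.sum_nonneg fun k _ => sq_nonneg _)
        by_contra! hlt
        have hlt' : i.val < K := hlt
        have hpos : i.val ≠ 0 := fun h => hi0 (Fin.ext h)
        refine hi (Finset.mem_map.mpr ⟨⟨i.val - 1, by omega⟩, Finset.mem_univ _, Fin.ext ?_⟩)
        rw [he]
        dsimp only
        omega
end
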